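/- Let f be a morphism of M with property P_fib and let f = h ∘ g be a factorization with g a trivial cofibration (of the original structure) and h a fibration (of the original structure). Then h has property P, i.e. every pullback of h is in W_loc. -/

import Mathlib

open CategoryTheory CategoryTheory.Limits

universe w v u

namespace Paper

variable {C : Type u} [Category.{v} C]

/-- `f` is a retract of `g` in the arrow category of `C`. -/
def IsRetractOf {X Y X' Y' : C} (f : X ⟶ Y) (g : X' ⟶ Y') : Prop :=
  ∃ (i : Arrow.mk f ⟶ Arrow.mk g) (r : Arrow.mk g ⟶ Arrow.mk f), i ≫ r = 𝟙 _

/-- A model structure on a (complete and cocomplete) category `C`, given by classes of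
cofibrations, fibrations and weak equivalences satisfying the usual axioms. -/
structure ModelStructure (C : Type u) [Category.{v} C] where
  cof : MorphismProperty C
  fib : MorphismProperty C
  weq : MorphismProperty C
  weq_comp : ∀ {X Y Z : C} (f : X ⟶ Y) (g : Y ⟶ Z), weq f → weq g → weq (f ≫ g)
  weq_of_comp_right : ∀ {X Y Z : C} (f : X ⟶ Y) (g : Y ⟶ Z), weq g → weq (f ≫ g) → weq f
  weq_of_comp_left : ∀ {X Y Z : C} (f : X ⟶ Y) (g : Y ⟶ Z), weq f → weq (f ≫ g) → weq g
  cof_retract : ∀ {X Y X' Y' : C} (f : X ⟶ Y) (g : X' ⟶ Y'), IsRetractOf f g → cof g → cof f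
  fib_retract : ∀ {X Y X' Y' : C} (f : X ⟶ Y) (g : X' ⟶ Y'), IsRetractOf f g → fib g → fib f
  weq_retract : ∀ {X Y X' Y' : C} (f : X ⟶ Y) (g : X' ⟶ Y'), IsRetractOf f g → weq g → weq f
  lifting_trivCof : ∀ {A B X Y : C} (i : A ⟶ B) (p : X ⟶ Y),
    cof i → weq i → fib p → HasLiftingProperty i p
  lifting_trivFib : ∀ {A B X Y : C} (i : A ⟶ B) (p : X ⟶ Y),
    cof i → fib p → weq p → HasLiftingProperty i p
  factor_trivCof_fib : ∀ {X Y : C} (f : X ⟶ Y),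
    ∃ (Z : C) (i : X ⟶ Z) (p : Z ⟶ Y), cof i ∧ weq i ∧ fib p ∧ i ≫ p = f
  factor_cof_trivFib : ∀ {X Y : C} (f : X ⟶ Y),
    ∃ (Z : C) (i : X ⟶ Z) (p : Z ⟶ Y), cof i ∧ fib p ∧ weq p ∧ i ≫ p = f

/-- Right properness: weak equivalences are stable under pullback along fibrations. -/
def ModelStructure.RightProper (M : ModelStructure C) : Prop :=
  ∀ ⦃P X Y' Y : C⦄ (fst : P ⟶ X) (snd : P ⟶ Y') (f : X ⟶ Y) (g : Y' ⟶ Y),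
    M.weq f → M.fib g → IsPullback fst snd f g → M.weq snd

/-- Left properness: weak equivalences are stable under pushout along cofibrations. -/
def ModelStructure.LeftProper (M : ModelStructure C) : Prop :=
  ∀ ⦃X Y Z P : C⦄ (f : X ⟶ Y) (g : X ⟶ Z) (inl : Y ⟶ P) (inr : Z ⟶ P),
    M.weq f → M.cof g → IsPushout f g inl inr → M.weq inr

/-- A left Bousfield localization of `M`: a second model structure with the same cofibrations
and a larger class of weak equivalences. -/
structure ModelStructure.IsBousfieldLocalization (M Mloc : ModelStructure C) : Prop where
  cof_eq : Mloc.cof = M.cof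
  weq_le : M.weq ≤ Mloc.weq

/-- A morphism has property `P` (w.r.t. a class `W`) if every pullback of it lies in `W`. -/
def PropertyP (W : MorphismProperty C) {X Y : C} (f : X ⟶ Y) : Prop :=
  ∀ ⦃P Y' : C⦄ (fst : P ⟶ X) (snd : P ⟶ Y') (g : Y' ⟶ Y), IsPullback fst snd f g → W snd

/-- A morphism has property `P_fib` (w.r.t. classes `F` of fibrations and `W`) if every
pullback of it along a morphism of `F` lies in `W`. -/
def PropertyPfib (F W : MorphismProperty C) {X Y : C} (f : X ⟶ Y) : Prop :=
  ∀ ⦃P Y' : C⦄ (fst : P ⟶ X) (snd : P ⟶ Y') (g : Y' ⟶ Y),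
    F g → IsPullback fst snd f g → W snd

end Paper

open Paper

namespace Paper

/-- A morphism with the right lifting property against trivial cofibrations is a fibration. -/
theorem ModelStructure.fib_of_hasLiftingProperty {C : Type u} [Category.{v} C]
    (M : ModelStructure C) {X Y : C} (p : X ⟶ Y)
    (hp : ∀ {A B : C} (i : A ⟶ B), M.cof i → M.weq i → HasLiftingProperty i p) :
    M.fib p := by
  obtain ⟨Z, i, q, hi, hi', hq, fac⟩ := M.factor_trivCof_fib p
  have := hp i hi hi'
  have sq : CommSq (𝟙 X) i p q := ⟨by simp [fac]⟩
  refine M.fib_retract p q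
    ⟨Arrow.homMk i (𝟙 Y) (by simp [fac]), Arrow.homMk sq.lift (𝟙 Y) (by simp), ?_⟩ hq
  ext <;> simp

/-- Fibrations are stable under pullback. -/
theorem ModelStructure.fib_of_isPullback {C : Type u} [Category.{v} C]
    (M : ModelStructure C) {P X Y' Y : C} {fst : P ⟶ X} {snd : P ⟶ Y'} {f : X ⟶ Y} {g : Y' ⟶ Y}
    (h : IsPullback fst snd f g) (hf : M.fib f) : M.fib snd :=
  M.fib_of_hasLiftingProperty snd fun i hi hi' =>
    have := M.lifting_trivCof i f hi hi' hf
    h.hasLiftingProperty i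

end Paper

/-- If `f` has property `P_fib` and `f = h ∘ g` with `g` a trivial cofibration and `h` a
fibration (of the original structure), then `h` has property `P`, i.e. every pullback of `h`
is in `W_loc`. -/
theorem stmt2 {C : Type u} [Category.{v} C] [HasLimits C] [HasColimits C]
    (M Mloc : ModelStructure C) (hloc : M.IsBousfieldLocalization Mloc)
    (hproper : M.RightProper)
    {X Y Z : C} (f : X ⟶ Y) (g : X ⟶ Z) (h : Z ⟶ Y)
    (hf : PropertyPfib M.fib Mloc.weq f)
    (hgcof : M.cof g) (hgweq : M.weq g) (hhfib : M.fib h)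
    (hfact : g ≫ h = f) :
    PropertyP Mloc.weq h := by
  intro P Y' fst snd k hP
  obtain ⟨Y'', w, p, -, hw, hp, rfl⟩ := M.factor_trivCof_fib k
  have hZ := IsPullback.of_hasPullback h p
  have hX := IsPullback.of_hasPullback g (pullback.fst h p)
  have hXY : IsPullback (pullback.fst g (pullback.fst h p))
      (pullback.snd g (pullback.fst h p) ≫ pullback.snd h p) f p :=
    hfact ▸ hX.paste_vert hZ
  have hg' := hproper _ _ _ _ hgweq (M.fib_of_isPullback hZ.flip hp) hX
  have hh' : Mloc.weq (pullback.snd h p) :=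
    Mloc.weq_of_comp_left _ _ (hloc.weq_le _ hg') (hf _ _ _ hp hXY)
  have hcomm : hZ.lift fst (snd ≫ w) (by simp [hP.w]) ≫ pullback.snd h p = snd ≫ w := by simp
  have hP' : IsPullback (hZ.lift fst (snd ≫ w) (by simp [hP.w])) snd (pullback.snd h p) w :=
    IsPullback.of_right (by simpa using hP) hcomm hZ
  have hlift := hproper _ _ _ _ hw (M.fib_of_isPullback hZ hhfib) hP'.flip
  refine Mloc.weq_of_comp_right snd w (hloc.weq_le _ hw) ?_
  rw [← hcomm]
  exact Mloc.weq_comp _ _ (hloc.weq_le _ hlift) hh'
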